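/- arXiv:1608.00994 — 3 statements merged into one kernel-verified Lean document; each statement's English description precedes it below -/
import Mathlib

section
/- Let ψ = ψ_A ⊗ ψ_B and φ = φ_A ⊗ φ_B be product vectors in ℂ^m ⊗ ℂ^n such that ψ_A and φ_A are linearly independent and ψ_B and φ_B are linearly independent. If ρ = a₀₀|ψ⟩⟨ψ| + a₀₁|ψ⟩⟨φ| + a₁₀|φ⟩⟨ψ| + a₁₁|φ⟩⟨φ| is a density matrix with a₁₀ ≠ 0, then ρ is not separable. -/
open scoped BigOperators ComplexOrder

/-- The outer product |u⟩⟨v|, with entries u x * conj (v y). -/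
noncomputable def outer {n : Type*} [Fintype n] (u v : n → ℂ) : Matrix n n ℂ :=
  Matrix.of fun x y => u x * (starRingEnd ℂ) (v y)

/-- The tensor product vector (a ⊗ b) (i, k) = a i * b k. -/
noncomputable def tens {m n : ℕ} (a : Fin m → ℂ) (b : Fin n → ℂ) :
    Fin m × Fin n → ℂ :=
  fun p => a p.1 * b p.2

/-- A product vector in ℂ^m ⊗ ℂ^n. -/
def IsProdVec {m n : ℕ} (v : Fin m × Fin n → ℂ) : Prop :=
  ∃ (a : Fin m → ℂ) (b : Fin n → ℂ), v = tens a b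

/-- A state is separable if it is a finite sum of outer products of product vectors. -/
noncomputable def Separable {m n : ℕ}
    (ρ : Matrix (Fin m × Fin n) (Fin m × Fin n) ℂ) : Prop :=
  ∃ (N : ℕ) (w : Fin N → (Fin m × Fin n → ℂ)),
    (∀ j, IsProdVec (w j)) ∧ ρ = ∑ j, outer (w j) (w j)

open Matrix in
/-- A finite linearly independent family of coordinate vectors has a dual family for the
bilinear dot product. -/
lemma LinearIndependent.exists_dotProduct_eq_ite {K ι κ : Type*} [Field K] [Fintype ι]
    [DecidableEq κ] {v : κ → ι → K} (hv : LinearIndependent K v) (k : κ) :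
    ∃ p : ι → K, ∀ i, p ⬝ᵥ v i = if i = k then 1 else 0 := by
  classical
  obtain ⟨g, hg⟩ := (Finsupp.linearCombination K v).exists_leftInverse_of_injective
    (LinearMap.ker_eq_bot.mpr hv)
  refine ⟨(dotProductEquiv K ι).symm (Finsupp.lapply k ∘ₗ g), fun i => ?_⟩
  have h := LinearMap.congr_fun hg (Finsupp.single i 1)
  simp only [LinearMap.comp_apply, Finsupp.linearCombination_single, one_smul,
    LinearMap.id_apply] at h
  rw [← dotProductEquiv_apply_apply, LinearEquiv.apply_symm_apply, LinearMap.comp_apply, h,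
    Finsupp.lapply_apply, Finsupp.single_apply]

open Matrix in
lemma tens_dotProduct_tens {m n : ℕ} (p a : Fin m → ℂ) (q b : Fin n → ℂ) :
    tens p q ⬝ᵥ tens a b = (p ⬝ᵥ a) * (q ⬝ᵥ b) := by
  simp only [dotProduct, tens, Fintype.sum_prod_type, Finset.sum_mul_sum]
  exact Finset.sum_congr rfl fun i _ => Finset.sum_congr rfl fun k _ => by ring

open Matrix in
lemma dotProduct_outer_mulVec_star {ι : Type*} [Fintype ι] (f g u v : ι → ℂ) :
    f ⬝ᵥ (outer u v *ᵥ star g) = (f ⬝ᵥ u) * star (g ⬝ᵥ v) := by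
  have h : outer u v = vecMulVec u (star v) := rfl
  rw [h, vecMulVec_mulVec, dotProduct_smul, star_dotProduct_star]
  simp

open Matrix in
/-- If a separable matrix has vanishing diagonal value at `p ⊗ s`, then its value between
`q ⊗ s` and `p ⊗ r` vanishes as well. -/
lemma Separable.dotProduct_mulVec_star_eq_zero {m n : ℕ}
    {ρ : Matrix (Fin m × Fin n) (Fin m × Fin n) ℂ} (hρ : Separable ρ)
    (p q : Fin m → ℂ) (r s : Fin n → ℂ)
    (h : tens p s ⬝ᵥ (ρ *ᵥ star (tens p s)) = 0) :
    tens q s ⬝ᵥ (ρ *ᵥ star (tens p r)) = 0 := by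
  obtain ⟨N, w, hw, rfl⟩ := hρ
  simp only [sum_mulVec, dotProduct_sum, dotProduct_outer_mulVec_star] at h ⊢
  rw [Finset.sum_eq_zero_iff_of_nonneg fun j _ => mul_star_self_nonneg _] at h
  refine Finset.sum_eq_zero fun j hj => ?_
  obtain ⟨a, b, hab⟩ := hw j
  have hz := h j hj
  rw [hab, tens_dotProduct_tens, CStarRing.mul_star_self_eq_zero_iff, mul_eq_zero] at hz
  rw [hab, tens_dotProduct_tens, tens_dotProduct_tens]
  rcases hz with hz | hz <;> simp [hz]

theorem offdiagonal_implies_entangled {m n : ℕ}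
    (ψA φA : Fin m → ℂ) (ψB φB : Fin n → ℂ)
    (hA : LinearIndependent ℂ ![ψA, φA])
    (hB : LinearIndependent ℂ ![ψB, φB])
    (a00 a01 a10 a11 : ℂ)
    (ρ : Matrix (Fin m × Fin n) (Fin m × Fin n) ℂ)
    (hdef : ρ = a00 • outer (tens ψA ψB) (tens ψA ψB)
      + a01 • outer (tens ψA ψB) (tens φA φB)
      + a10 • outer (tens φA φB) (tens ψA ψB)
      + a11 • outer (tens φA φB) (tens φA φB))
    (hρ : ρ.PosSemidef) (htr : ρ.trace = 1)
    (h10 : a10 ≠ 0) :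
    ¬ Separable ρ := by
  intro hsep
  obtain ⟨p, hp⟩ := hA.exists_dotProduct_eq_ite 0
  obtain ⟨q, hq⟩ := hA.exists_dotProduct_eq_ite 1
  obtain ⟨r, hr⟩ := hB.exists_dotProduct_eq_ite 0
  obtain ⟨s, hs⟩ := hB.exists_dotProduct_eq_ite 1
  simp only [Fin.forall_fin_two, Matrix.cons_val_zero, Matrix.cons_val_one, if_true,
    zero_ne_one, one_ne_zero, if_false] at hp hq hr hs
  have h := hsep.dotProduct_mulVec_star_eq_zero p q r s
  simp only [hdef, Matrix.add_mulVec, Matrix.smul_mulVec, dotProduct_add, dotProduct_smul,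
    dotProduct_outer_mulVec_star, tens_dotProduct_tens, hp, hq, hr, hs] at h
  exact h10 (by simpa using h)
end

section
/- In ℂ² ⊗ ℂ², let ψ = e₀ ⊗ e₀ and φ = e₊ ⊗ e₊ where e₊ = (e₀ + e₁)/√2. A density matrix of the form ρ = a₀₀|ψ⟩⟨ψ| + a₀₁|ψ⟩⟨φ| + a₁₀|φ⟩⟨ψ| + a₁₁|φ⟩⟨φ| is separable if and only if a₀₁ = 0 and a₁₀ = 0; i.e., the separable states in the Bloch ball of span{|00⟩, |++⟩} are exactly those on the line connecting the two non-orthogonal product states. -/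
open scoped BigOperators ComplexOrder

/-- The standard basis vector e₀ of ℂ². -/
noncomputable def e0 : Fin 2 → ℂ := ![1, 0]

/-- The standard basis vector e₁ of ℂ². -/
noncomputable def e1 : Fin 2 → ℂ := ![0, 1]

/-- The vector e₊ = (e₀ + e₁)/√2. -/
noncomputable def ePlus : Fin 2 → ℂ := (1 / (Real.sqrt 2 : ℂ)) • (e0 + e1)

theorem tens_e0_e0 (p : Fin 2 × Fin 2) : tens e0 e0 p = if p = (0, 0) then 1 else 0 := by
  obtain ⟨i, j⟩ := p
  fin_cases i <;> fin_cases j <;> simp [tens, e0]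

theorem tens_ePlus_ePlus (p : Fin 2 × Fin 2) : tens ePlus ePlus p = 1 / 2 := by
  have h : ∀ i, ePlus i = 1 / (Real.sqrt 2 : ℂ) := by
    intro i
    fin_cases i <;> simp [ePlus, e0, e1]
  have h2 : (Real.sqrt 2 : ℂ) * (Real.sqrt 2 : ℂ) = 2 := by
    exact_mod_cast Real.mul_self_sqrt (by norm_num : (0 : ℝ) ≤ 2)
  rw [tens, h, h, div_mul_div_comm, h2, one_mul]

/-- The entries of an operator supported on the span of `e₀ ⊗ e₀` and `e₊ ⊗ e₊`. -/
theorem span_operator_apply (a00 a01 a10 a11 : ℂ) (x y : Fin 2 × Fin 2) :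
    (a00 • outer (tens e0 e0) (tens e0 e0)
      + a01 • outer (tens e0 e0) (tens ePlus ePlus)
      + a10 • outer (tens ePlus ePlus) (tens e0 e0)
      + a11 • outer (tens ePlus ePlus) (tens ePlus ePlus)) x y
    = a00 * ((if x = (0, 0) then 1 else 0) * (if y = (0, 0) then 1 else 0))
      + a01 * ((if x = (0, 0) then 1 else 0) / 2)
      + a10 * ((if y = (0, 0) then 1 else 0) / 2) + a11 / 4 := by
  simp only [Matrix.add_apply, Matrix.smul_apply, outer, Matrix.of_apply, tens_e0_e0,
    tens_ePlus_ePlus, smul_eq_mul, apply_ite (starRingEnd ℂ), map_one, map_zero, map_div₀,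
    map_ofNat]
  ring

theorem IsProdVec.mul_eq_mul {m n : ℕ} {v : Fin m × Fin n → ℂ} (hv : IsProdVec v)
    (i k : Fin m) (j l : Fin n) : v (i, j) * v (k, l) = v (i, l) * v (k, j) := by
  obtain ⟨a, b, rfl⟩ := hv
  simp only [tens]
  ring

theorem IsProdVec.smul {m n : ℕ} {v : Fin m × Fin n → ℂ} (hv : IsProdVec v) (c : ℂ) :
    IsProdVec (c • v) := by
  obtain ⟨a, b, rfl⟩ := hv
  refine ⟨c • a, b, ?_⟩
  ext p
  simp [tens, mul_assoc]

theorem outer_sqrt_smul_self {n : Type*} [Fintype n] {r : ℝ} (hr : 0 ≤ r) (v : n → ℂ) :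
    outer ((Real.sqrt r : ℂ) • v) ((Real.sqrt r : ℂ) • v) = (r : ℂ) • outer v v := by
  have h : (Real.sqrt r : ℂ) * (Real.sqrt r : ℂ) = r := by
    exact_mod_cast Real.mul_self_sqrt hr
  ext x y
  simp only [outer, Matrix.of_apply, Matrix.smul_apply, Pi.smul_apply, smul_eq_mul, map_mul,
    Complex.conj_ofReal, ← h]
  ring

theorem separable_smul_outer_add_smul_outer {m n : ℕ} {u v : Fin m × Fin n → ℂ}
    (hu : IsProdVec u) (hv : IsProdVec v) {a b : ℂ} (ha : 0 ≤ a) (hb : 0 ≤ b) :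
    Separable (a • outer u u + b • outer v v) := by
  obtain ⟨r, hr, rfl⟩ := RCLike.nonneg_iff_exists_ofReal.mp ha
  obtain ⟨s, hs, rfl⟩ := RCLike.nonneg_iff_exists_ofReal.mp hb
  refine ⟨2, ![(Real.sqrt r : ℂ) • u, (Real.sqrt s : ℂ) • v], ?_, ?_⟩
  · rw [Fin.forall_fin_two]
    exact ⟨hu.smul _, hv.smul _⟩
  · rw [Fin.sum_univ_two]
    exact (congrArg₂ _ (outer_sqrt_smul_self hr u) (outer_sqrt_smul_self hs v)).symm

/-- If `e_x - e_y` lies in the kernel of `∑ j, |w_j⟩⟨w_j|`, the coordinates `x` and `y` of every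
`w_j` agree. -/
theorem apply_eq_apply_of_sum_outer {n ι : Type*} [Fintype n] [Fintype ι] {w : ι → n → ℂ}
    {x y : n}
    (h : (∑ j, outer (w j) (w j)) x x - (∑ j, outer (w j) (w j)) x y
      - (∑ j, outer (w j) (w j)) y x + (∑ j, outer (w j) (w j)) y y = 0) (j : ι) :
    w j x = w j y := by
  have hs : ∑ j, ((Complex.normSq (w j x - w j y) : ℝ) : ℂ) = 0 := by
    rw [← h]
    simp only [Matrix.sum_apply, outer, Matrix.of_apply, ← Finset.sum_sub_distrib,
      ← Finset.sum_add_distrib]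
    refine Finset.sum_congr rfl fun j _ => ?_
    rw [← Complex.mul_conj, map_sub]
    ring
  have hr : ∑ j, Complex.normSq (w j x - w j y) = 0 := by exact_mod_cast hs
  have hj := (Finset.sum_eq_zero_iff_of_nonneg fun j _ => Complex.normSq_nonneg _).mp hr j
    (Finset.mem_univ j)
  exact sub_eq_zero.mp (Complex.normSq_eq_zero.mp hj)

theorem Matrix.PosSemidef.sub_sub_add_nonneg {n : Type*} [Fintype n] [DecidableEq n]
    {A : Matrix n n ℂ} (hA : A.PosSemidef) (x y : n) :
    0 ≤ A x x - A x y - A y x + A y y := by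
  have h := hA.dotProduct_mulVec_nonneg (Pi.single x 1 - Pi.single y 1)
  simp only [Matrix.mulVec_sub, star_sub, sub_dotProduct, dotProduct_sub, Pi.star_single,
    star_one, Matrix.mulVec_single_one, single_one_dotProduct, Matrix.col_apply] at h
  convert h using 1
  ring

theorem class_three_example (a00 a01 a10 a11 : ℂ)
    (ρ : Matrix (Fin 2 × Fin 2) (Fin 2 × Fin 2) ℂ)
    (hdef : ρ = a00 • outer (tens e0 e0) (tens e0 e0)
      + a01 • outer (tens e0 e0) (tens ePlus ePlus)
      + a10 • outer (tens ePlus ePlus) (tens e0 e0)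
      + a11 • outer (tens ePlus ePlus) (tens ePlus ePlus))
    (hρ : ρ.PosSemidef) (htr : ρ.trace = 1) :
    Separable ρ ↔ a01 = 0 ∧ a10 = 0 := by
  have entry : ∀ x y, ρ x y = _ := fun x y =>
    (congrFun₂ hdef x y).trans (span_operator_apply a00 a01 a10 a11 x y)
  constructor
  · rintro ⟨N, w, hw, hsum⟩
    have h10 : ∀ j, w j (0, 1) = w j (1, 0) := by
      refine apply_eq_apply_of_sum_outer ?_
      rw [← hsum]
      simp [entry]
    have h11 : ∀ j, w j (0, 1) = w j (1, 1) := by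
      refine apply_eq_apply_of_sum_outer ?_
      rw [← hsum]
      simp [entry]
    have hcases : ∀ j, w j (0, 1) = 0 ∨ w j (0, 0) = w j (0, 1) := by
      intro j
      have h := (hw j).mul_eq_mul 0 1 0 1
      rw [← h10, ← h11] at h
      exact (mul_eq_mul_right_iff.mp h).symm
    have hrow : ρ (0, 0) (0, 1) = ρ (0, 1) (0, 1) := by
      simp only [hsum, Matrix.sum_apply, outer, Matrix.of_apply]
      refine Finset.sum_congr rfl fun j _ => ?_
      rcases hcases j with h | h <;> simp [h]
    have hcol : ρ (0, 1) (0, 0) = ρ (0, 1) (0, 1) := by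
      simp only [hsum, Matrix.sum_apply, outer, Matrix.of_apply]
      refine Finset.sum_congr rfl fun j _ => ?_
      rcases hcases j with h | h <;> simp [h]
    constructor
    · simpa [entry] using hrow
    · simpa [entry] using hcol
  · rintro ⟨rfl, rfl⟩
    have h0 : 0 ≤ a00 := by
      have h := hρ.sub_sub_add_nonneg (0, 0) (0, 1)
      simpa [entry] using h
    have h1 : 0 ≤ a11 := by
      have h := hρ.diag_nonneg (i := (0, 1))
      have h4 : a11 = 4 * ρ (0, 1) (0, 1) := by
        simp [entry]
        ring
      rw [h4]
      exact mul_nonneg (by norm_num) h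
    rw [hdef, zero_smul, zero_smul, add_zero, add_zero]
    exact separable_smul_outer_add_smul_outer ⟨_, _, rfl⟩ ⟨_, _, rfl⟩ h0 h1
end

section
/- For three qubits, let ψ = e₀ ⊗ e₀ ⊗ e₀ (|000⟩) and φ = e₁ ⊗ e₁ ⊗ e₁ (|111⟩), viewed as vectors (Fin 2 × Fin 2 × Fin 2) → ℂ. If ρ = a₀₀|ψ⟩⟨ψ| + a₀₁|ψ⟩⟨φ| + a₁₀|φ⟩⟨ψ| + a₁₁|φ⟩⟨φ| is a density matrix with a₁₀ ≠ 0, then ρ is entangled (not separable) with respect to each of the three bipartite partitions {1}|{2,3}, {2}|{1,3}, and {3}|{1,2} of the qubits. -/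
open scoped BigOperators ComplexOrder

/-- Product vector across the bipartition {1}|{2,3}. -/
def IsProdVec1 (v : Fin 2 × Fin 2 × Fin 2 → ℂ) : Prop :=
  ∃ (a : Fin 2 → ℂ) (b : Fin 2 × Fin 2 → ℂ),
    ∀ i j k, v (i, j, k) = a i * b (j, k)

/-- Product vector across the bipartition {2}|{1,3}. -/
def IsProdVec2 (v : Fin 2 × Fin 2 × Fin 2 → ℂ) : Prop :=
  ∃ (a : Fin 2 → ℂ) (b : Fin 2 × Fin 2 → ℂ),
    ∀ i j k, v (i, j, k) = a j * b (i, k)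

/-- Product vector across the bipartition {3}|{1,2}. -/
def IsProdVec3 (v : Fin 2 × Fin 2 × Fin 2 → ℂ) : Prop :=
  ∃ (a : Fin 2 → ℂ) (b : Fin 2 × Fin 2 → ℂ),
    ∀ i j k, v (i, j, k) = a k * b (i, j)

/-- Separability with respect to the bipartition {1}|{2,3}. -/
noncomputable def Separable1
    (ρ : Matrix (Fin 2 × Fin 2 × Fin 2) (Fin 2 × Fin 2 × Fin 2) ℂ) : Prop :=
  ∃ (N : ℕ) (w : Fin N → (Fin 2 × Fin 2 × Fin 2 → ℂ)),
    (∀ j, IsProdVec1 (w j)) ∧ ρ = ∑ j, outer (w j) (w j)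

/-- Separability with respect to the bipartition {2}|{1,3}. -/
noncomputable def Separable2
    (ρ : Matrix (Fin 2 × Fin 2 × Fin 2) (Fin 2 × Fin 2 × Fin 2) ℂ) : Prop :=
  ∃ (N : ℕ) (w : Fin N → (Fin 2 × Fin 2 × Fin 2 → ℂ)),
    (∀ j, IsProdVec2 (w j)) ∧ ρ = ∑ j, outer (w j) (w j)

/-- Separability with respect to the bipartition {3}|{1,2}. -/
noncomputable def Separable3
    (ρ : Matrix (Fin 2 × Fin 2 × Fin 2) (Fin 2 × Fin 2 × Fin 2) ℂ) : Prop :=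
  ∃ (N : ℕ) (w : Fin N → (Fin 2 × Fin 2 × Fin 2 → ℂ)),
    (∀ j, IsProdVec3 (w j)) ∧ ρ = ∑ j, outer (w j) (w j)

/-- |000⟩. -/
noncomputable def ψ000 : Fin 2 × Fin 2 × Fin 2 → ℂ :=
  fun x => e0 x.1 * e0 x.2.1 * e0 x.2.2

/-- |111⟩. -/
noncomputable def ψ111 : Fin 2 × Fin 2 × Fin 2 → ℂ :=
  fun x => e1 x.1 * e1 x.2.1 * e1 x.2.2

/-- If a diagonal entry of `∑ j, |w j⟩⟨w j|` vanishes, then so does the corresponding coordinate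
of every `w j`. -/
theorem eq_zero_of_sum_outer_self_apply_eq_zero {ι n : Type*} [Fintype ι] [Fintype n]
    {w : ι → n → ℂ} {s : n} (h : (∑ j, outer (w j) (w j)) s s = 0) (j : ι) : w j s = 0 := by
  simp only [Matrix.sum_apply, outer, Matrix.of_apply, starRingEnd_apply] at h
  rw [Finset.sum_eq_zero_iff_of_nonneg fun i _ => mul_star_self_nonneg (w i s)] at h
  simpa using h j (Finset.mem_univ j)

/-- If every `w j` satisfies `w j x * w j y = w j s * w j t` and the diagonal entry of
`∑ j, |w j⟩⟨w j|` at `s` vanishes, then its entry at `(x, y)` vanishes. -/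
theorem sum_outer_self_apply_eq_zero {ι n : Type*} [Fintype ι] [Fintype n]
    {w : ι → n → ℂ} {x y s t : n} (hw : ∀ j, w j x * w j y = w j s * w j t)
    (h : (∑ j, outer (w j) (w j)) s s = 0) : (∑ j, outer (w j) (w j)) x y = 0 := by
  simp only [Matrix.sum_apply, outer, Matrix.of_apply]
  refine Finset.sum_eq_zero fun j _ => ?_
  have hj := hw j
  rw [eq_zero_of_sum_outer_self_apply_eq_zero h j, zero_mul, mul_eq_zero] at hj
  simpa using hj

theorem ghz_sphere_entangled_wrt_all_bipartitions (a00 a01 a10 a11 : ℂ)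
    (ρ : Matrix (Fin 2 × Fin 2 × Fin 2) (Fin 2 × Fin 2 × Fin 2) ℂ)
    (hdef : ρ = a00 • outer ψ000 ψ000 + a01 • outer ψ000 ψ111
      + a10 • outer ψ111 ψ000 + a11 • outer ψ111 ψ111)
    (hρ : ρ.PosSemidef) (htr : ρ.trace = 1)
    (h10 : a10 ≠ 0) :
    ¬ Separable1 ρ ∧ ¬ Separable2 ρ ∧ ¬ Separable3 ρ := by
  have hcoh : ρ (1, 1, 1) (0, 0, 0) ≠ 0 := by
    simpa [hdef, outer, ψ000, ψ111, e0, e1] using h10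
  refine ⟨?_, ?_, ?_⟩ <;> rintro ⟨N, w, hw, hsum⟩ <;> apply hcoh
  · have hdiag : ρ (0, 1, 1) (0, 1, 1) = 0 := by
      simp [hdef, outer, ψ000, ψ111, e0, e1]
    rw [hsum] at hdiag ⊢
    refine sum_outer_self_apply_eq_zero (t := (1, 0, 0)) (fun j => ?_) hdiag
    obtain ⟨a, b, h⟩ := hw j
    simp only [h]
    ring
  · have hdiag : ρ (1, 0, 1) (1, 0, 1) = 0 := by
      simp [hdef, outer, ψ000, ψ111, e0, e1]
    rw [hsum] at hdiag ⊢
    refine sum_outer_self_apply_eq_zero (t := (0, 1, 0)) (fun j => ?_) hdiag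
    obtain ⟨a, b, h⟩ := hw j
    simp only [h]
    ring
  · have hdiag : ρ (1, 1, 0) (1, 1, 0) = 0 := by
      simp [hdef, outer, ψ000, ψ111, e0, e1]
    rw [hsum] at hdiag ⊢
    refine sum_outer_self_apply_eq_zero (t := (0, 0, 1)) (fun j => ?_) hdiag
    obtain ⟨a, b, h⟩ := hw j
    simp only [h]
    ring
end
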